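/- Every continuous map f : Dⁿ → Dⁿ from the closed n-disk to itself has a fixed point (Brouwer fixed point theorem). -/

import Mathlib

open Metric MeasureTheory Set Filter Topology

theorem bfp_det_interp {n : ℕ} (A : EuclideanSpace ℝ (Fin n) →L[ℝ] EuclideanSpace ℝ (Fin n))
    (s : Finset ℕ) (v : ℕ → ℝ) (hv : Set.InjOn v s) (hs : n < s.card) :
    (1 + A).det = ∑ i ∈ s, (1 + v i • A).det * (Lagrange.basis s v i).eval 1 := by
  classical
  let b := (EuclideanSpace.basisFun (Fin n) ℝ).toBasis
  let M := LinearMap.toMatrix b b (A : _ →ₗ[ℝ] _)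
  let p : Polynomial ℝ := Matrix.det ((Polynomial.X : Polynomial ℝ) • M.map Polynomial.C +
    (1 : Matrix (Fin n) (Fin n) ℝ).map Polynomial.C)
  have hp : p.natDegree ≤ n := by
    have := Polynomial.natDegree_det_X_add_C_le M 1
    rwa [Fintype.card_fin] at this
  have he : ∀ t : ℝ, p.eval t = (1 + t • A).det := by
    intro t
    have h1 : (1 + t • A).det = Matrix.det (1 + t • M) := by
      change LinearMap.det _ = _
      rw [← LinearMap.det_toMatrix b]
      congr 1
      simp [M, LinearMap.toMatrix_one, ContinuousLinearMap.toLinearMap_add,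
        ContinuousLinearMap.toLinearMap_smul]
    rw [h1]
    simp only [p]
    rw [← Polynomial.coe_evalRingHom, RingHom.map_det]
    congr 1
    ext i j
    by_cases hij : i = j <;> simp [hij] <;> ring
  have hd : p.degree < s.card :=
    lt_of_le_of_lt (Polynomial.degree_le_of_natDegree_le hp) (by exact_mod_cast hs)
  have h1 := Lagrange.eq_interpolate hv hd
  have h2 := congrArg (Polynomial.eval 1) h1
  rw [he, one_smul] at h2
  rw [h2, Lagrange.interpolate_apply, Polynomial.eval_finsetSum]
  simp [he]

theorem bfp_lip {E : Type*} [NormedAddCommGroup E] [NormedSpace ℝ E] {h : E → E} {K : NNReal}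
    (hK : LipschitzOnWith K h (closedBall 0 1)) (h0 : ∀ x, ‖x‖ = 1 → h x = 0) :
    LipschitzWith K ((closedBall (0 : E) 1).indicator h) := by
  classical
  have key : ∀ x y : E, ‖x‖ ≤ 1 → 1 < ‖y‖ → ‖h x‖ ≤ K * ‖x - y‖ := by
    intro x y hx hy
    have hc : ContinuousOn (fun t : ℝ => ‖x + t • (y - x)‖) (Icc 0 1) := by fun_prop
    obtain ⟨t, ht, ht1⟩ := intermediate_value_Icc (zero_le_one) hc
      (show (1 : ℝ) ∈ _ by constructor <;> simp [hx, hy.le])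
    simp only at ht1
    have := hK.norm_sub_le (x := x) (y := x + t • (y - x)) (by simpa using hx)
      (by simp [ht1])
    rw [h0 _ ht1, sub_zero] at this
    refine this.trans ?_
    gcongr
    have e : x - (x + t • (y - x)) = t • (x - y) := by module
    rw [e, norm_smul, Real.norm_of_nonneg ht.1]
    exact mul_le_of_le_one_left (norm_nonneg _) ht.2
  refine LipschitzWith.of_dist_le_mul fun x y => ?_
  rw [dist_eq_norm, dist_eq_norm]
  by_cases hx : ‖x‖ ≤ 1 <;> by_cases hy : ‖y‖ ≤ 1
  · simpa [indicator, hx, hy] using hK.norm_sub_le (x := x) (y := y) (by simpa) (by simpa)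
  · simpa [indicator, hx, hy] using key x y hx (not_le.1 hy)
  · simpa [indicator, hx, hy, norm_sub_rev x y] using key y x hy (not_le.1 hx)
  · simp [indicator, hx, hy]; positivity

theorem bfp_image {E : Type*} [NormedAddCommGroup E] [NormedSpace ℝ E] [CompleteSpace E]
    {h : E → E} {K : NNReal}
    (hK : LipschitzOnWith K h (closedBall 0 1)) (h0 : ∀ x, ‖x‖ = 1 → h x = 0)
    (hm : ∀ x, ‖x‖ ≤ 1 → ‖x + h x‖ ≤ 1)
    {t : ℝ} (ht : 0 ≤ t) (ht1 : t ≤ 1) (htK : t * K < 1) :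
    InjOn (fun x => x + t • h x) (closedBall 0 1) ∧
    (fun x => x + t • h x) '' (closedBall 0 1) = closedBall 0 1 := by
  constructor
  · intro x hx y hy hxy
    have h1 := hK.norm_sub_le hx hy
    simp only at hxy
    have h2 : x - y = -(t • (h x - h y)) := by
      have : x - y + t • (h x - h y) = 0 := by
        rw [← sub_eq_zero] at hxy
        rw [← hxy]; module
      exact eq_neg_of_add_eq_zero_left this
    have h3 : ‖x - y‖ = t * ‖h x - h y‖ := by
      rw [h2, norm_neg, norm_smul, Real.norm_of_nonneg ht]
    have h4 : ‖x - y‖ ≤ t * K * ‖x - y‖ := by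
      rw [mul_assoc]; nlinarith
    have h5 : ‖x - y‖ = 0 := by nlinarith [norm_nonneg (x - y)]
    exact sub_eq_zero.1 (norm_eq_zero.1 h5)
  · apply Subset.antisymm
    · rintro _ ⟨x, hx, rfl⟩
      have hx' : ‖x‖ ≤ 1 := by simpa using hx
      have e : x + t • h x = (1 - t) • x + t • (x + h x) := by module
      simp only [mem_closedBall, dist_zero_right, e]
      refine (norm_add_le _ _).trans ?_
      rw [norm_smul, norm_smul, Real.norm_of_nonneg ht, Real.norm_of_nonneg (by linarith)]
      nlinarith [hm x hx']
    · intro y hy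
      have hL := bfp_lip hK h0
      set g := (closedBall (0 : E) 1).indicator h with hg
      have hc : ContractingWith (Real.toNNReal t * K) (fun x => y - t • g x) := by
        refine ⟨by rw [← NNReal.coe_lt_coe]; simpa [ht] using htK, LipschitzWith.of_dist_le_mul fun a b => ?_⟩
        have := hL.dist_le_mul a b
        rw [dist_sub_left, dist_smul₀, Real.norm_of_nonneg ht]
        rw [NNReal.coe_mul, Real.coe_toNNReal _ ht, mul_assoc]
        exact mul_le_mul_of_nonneg_left this ht
      have hf := hc.fixedPoint_isFixedPt
      set x := ContractingWith.fixedPoint _ hc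
      have hf' : y - t • g x = x := hf
      by_cases hx : x ∈ closedBall (0 : E) 1
      · refine ⟨x, hx, ?_⟩
        have : g x = h x := by simp only [hg]; exact indicator_of_mem hx _
        rw [this] at hf'
        simp only
        nth_rewrite 1 [← hf']
        abel
      · have : g x = 0 := by simp only [hg]; exact indicator_of_notMem hx _
        rw [this] at hf'
        simp at hf'
        exact absurd (hf' ▸ hy) hx

theorem bfp_det_zero {n : ℕ} {h : EuclideanSpace ℝ (Fin n) → EuclideanSpace ℝ (Fin n)}
    {x : EuclideanSpace ℝ (Fin n)} (hd : DifferentiableAt ℝ h x)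
    (h1 : ∀ᶠ y in 𝓝 x, ‖y + h y‖ = 1) : (1 + fderiv ℝ h x).det = 0 := by
  by_contra hne
  have hr : HasFDerivAt (fun y => y + h y) (1 + fderiv ℝ h x) x :=
    (hasFDerivAt_id x).add hd.hasFDerivAt
  have hsq := hr.norm_sq
  have hc : HasFDerivAt (fun y => ‖y + h y‖ ^ 2) (0 : EuclideanSpace ℝ (Fin n) →L[ℝ] ℝ) x := by
    refine (hasFDerivAt_const (1 : ℝ) x).congr_of_eventuallyEq ?_
    filter_upwards [h1] with y hy
    simp [hy]
  have heq := hsq.unique hc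
  have hu : ∀ w, ∃ v, (1 + fderiv ℝ h x : EuclideanSpace ℝ (Fin n) →L[ℝ] EuclideanSpace ℝ (Fin n)) v = w := by
    have h2 : LinearMap.det ((1 + fderiv ℝ h x : EuclideanSpace ℝ (Fin n) →L[ℝ] _) :
      EuclideanSpace ℝ (Fin n) →ₗ[ℝ] EuclideanSpace ℝ (Fin n)) ≠ 0 := hne
    exact (LinearMap.equivOfDetNeZero _ h2).surjective
  obtain ⟨v, hv⟩ := hu (x + h x)
  have h3 := congrArg (fun L => L v) heq
  have h4 := h1.self_of_nhds
  simp only [ContinuousLinearMap.smul_apply, ContinuousLinearMap.comp_apply, hv,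
    innerSL_apply_apply, ContinuousLinearMap.zero_apply, real_inner_self_eq_norm_sq, h4] at h3
  norm_num at h3

theorem bfp_no_retract {n : ℕ} {h : EuclideanSpace ℝ (Fin n) → EuclideanSpace ℝ (Fin n)}
    {U : Set (EuclideanSpace ℝ (Fin n))} (hU : IsOpen U) (hBU : closedBall 0 1 ⊆ U)
    (hC : ContDiffOn ℝ 1 h U) (h0 : ∀ x, ‖x‖ = 1 → h x = 0)
    (h1 : ∀ x ∈ U, ‖x + h x‖ = 1) : False := by
  set B := closedBall (0 : EuclideanSpace ℝ (Fin n)) 1 with hB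
  have hBc : IsCompact B := isCompact_closedBall _ _
  obtain ⟨K, hK⟩ := (hC.mono hBU).exists_lipschitzOnWith one_ne_zero (convex_closedBall 0 1) hBc
  have hA : ContinuousOn (fderiv ℝ h) U := hC.continuousOn_fderiv_of_isOpen hU le_rfl
  have hd : ∀ x ∈ U, DifferentiableAt ℝ h x := fun x hx =>
    (hC.differentiableOn one_ne_zero).differentiableAt (hU.mem_nhds hx)
  have hdetc : ∀ t : ℝ, ContinuousOn (fun x => (1 + t • fderiv ℝ h x).det) B := fun t =>
    ContinuousLinearMap.continuous_det.comp_continuousOn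
      (continuousOn_const.add ((hA.mono hBU).const_smul t))
  have hpos : ∀ᶠ t : ℝ in 𝓝 0, ∀ x ∈ B, 0 < (1 + t • fderiv ℝ h x).det := by
    apply hBc.eventually_forall_of_forall_eventually
    intro y hy
    have hc : ContinuousAt (fun z : ℝ × EuclideanSpace ℝ (Fin n) =>
        (1 + z.1 • fderiv ℝ h z.2).det) (0, y) := by
      refine ContinuousLinearMap.continuous_det.continuousAt.comp ?_
      refine continuousAt_const.add (continuousAt_fst.smul ?_)
      exact ContinuousAt.comp (f := Prod.snd) (g := fderiv ℝ h) (x := ((0 : ℝ), y))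
        (hA.continuousAt (hU.mem_nhds (hBU hy))) continuousAt_snd
    refine hc.eventually (lt_mem_nhds ?_)
    simp [ContinuousLinearMap.det]
  have hKt : ∀ᶠ t : ℝ in 𝓝 0, t * K < 1 :=
    (show ContinuousAt (fun t : ℝ => t * K) 0 by fun_prop).eventually (gt_mem_nhds (by simp))
  have ht1 : ∀ᶠ t : ℝ in 𝓝 0, t < 1 := gt_mem_nhds one_pos
  obtain ⟨ε, hε, hall⟩ := Metric.eventually_nhds_iff.1 (hpos.and (hKt.and ht1))
  have hint : ∀ t : ℝ, 0 < t → t < ε →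
      ∫ x in B, (1 + t • fderiv ℝ h x).det = (volume B).toReal := by
    intro t ht htε
    obtain ⟨hp, hk, hl⟩ := hall (y := t) (by simpa [abs_of_pos ht] using htε)
    obtain ⟨hi, him⟩ := bfp_image hK h0 (fun x hx => (h1 x (hBU (by simpa [hB] using hx))).le)
      ht.le hl.le hk
    have hcv := lintegral_abs_det_fderiv_eq_addHaar_image volume (s := B)
      (f := fun x => x + t • h x) (f' := fun x => 1 + t • fderiv ℝ h x)
      hBc.measurableSet
      (fun x hx => ((hasFDerivAt_id x).add
        ((hd x (hBU hx)).hasFDerivAt.const_smul t)).hasFDerivWithinAt) hi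
    rw [him] at hcv
    rw [integral_eq_lintegral_of_nonneg_ae]
    · congr 1
      refine Eq.trans ?_ hcv
      apply setLIntegral_congr_fun hBc.measurableSet
      intro x hx
      simp only
      rw [abs_of_pos (hp x hx)]
    · exact (ae_restrict_mem hBc.measurableSet).mono fun x hx => (hp x hx).le
    · exact (hdetc t).aestronglyMeasurable hBc.measurableSet
  let s := Finset.range (n + 1)
  let v : ℕ → ℝ := fun i => ε / (i + 2)
  have hv : InjOn v s := by
    intro i _ j _ hij
    simp only [v] at hij
    field_simp at hij
    have : (i : ℝ) = j := by linarith
    exact_mod_cast this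
  have hvp : ∀ i, 0 < v i := fun i => by positivity
  have hvε : ∀ i, v i < ε := fun i => by
    simp only [v]
    apply div_lt_self hε
    have : (0 : ℝ) ≤ i := by positivity
    linarith
  have hz : ∫ x in B, (1 + fderiv ℝ h x).det = 0 := by
    rw [setIntegral_congr_fun (g := fun _ => (0 : ℝ)) hBc.measurableSet]
    · simp
    · intro x hx
      exact bfp_det_zero (hd x (hBU hx)) (Filter.mem_of_superset (hU.mem_nhds (hBU hx)) h1)
  have hs : ∫ x in B, (1 + fderiv ℝ h x).det = (volume B).toReal := by
    simp_rw [fun x => bfp_det_interp (fderiv ℝ h x) s v hv (by simp [s])]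
    rw [integral_finsetSum]
    · simp_rw [integral_mul_const, hint _ (hvp _) (hvε _)]
      rw [← Finset.mul_sum, ← Polynomial.eval_finsetSum, Lagrange.sum_basis hv (by simp [s])]
      simp
    · intro i _
      exact ((hdetc (v i)).integrableOn_compact hBc).mul_const _
  rw [hz] at hs
  have hv0 : 0 < (volume B).toReal :=
    ENNReal.toReal_pos (measure_closedBall_pos _ _ one_pos).ne' hBc.measure_lt_top.ne
  linarith

theorem bfp_smooth {n : ℕ} {F : EuclideanSpace ℝ (Fin n) → EuclideanSpace ℝ (Fin n)}
    (hF : ContDiff ℝ 1 F) (h1 : ∀ x, ‖x‖ ≤ 1 → ‖F x‖ < 1)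
    (h2 : ∀ x, ‖x‖ ≤ 1 → F x ≠ x) : False := by
  let u := fun x => x - F x
  have hu : ContDiff ℝ 1 u := contDiff_id.sub hF
  let D : EuclideanSpace ℝ (Fin n) → ℝ :=
    fun x => (inner ℝ x (u x)) ^ 2 + ‖u x‖ ^ 2 * (1 - ‖x‖ ^ 2)
  have hD : ContDiff ℝ 1 D :=
    ((contDiff_id.inner ℝ hu).pow 2).add
      ((hu.norm_sq ℝ).mul (contDiff_const.sub (contDiff_id.norm_sq ℝ)))
  let l : EuclideanSpace ℝ (Fin n) → ℝ :=
    fun x => (-(inner ℝ x (u x)) + √(D x)) / ‖u x‖ ^ 2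
  have hsph : ∀ x, ‖x‖ = 1 → 0 < inner ℝ x (u x) := by
    intro x hx
    have := real_inner_le_norm x (F x)
    have h3 := h1 x hx.le
    simp only [u, inner_sub_right, real_inner_self_eq_norm_sq, hx] at *
    linarith
  have hune : ∀ x, ‖x‖ ≤ 1 → u x ≠ 0 := fun x hx => sub_ne_zero.2 (h2 x hx).symm
  refine bfp_no_retract (h := fun x => l x • u x) (U := {x | u x ≠ 0 ∧ 0 < D x}) ?_ ?_ ?_ ?_ ?_
  · exact (isOpen_ne.preimage hu.continuous).inter (isOpen_lt continuous_const hD.continuous)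
  · intro x hx
    have hx : ‖x‖ ≤ 1 := by simpa using hx
    refine ⟨hune x hx, ?_⟩
    simp only [D]
    rcases hx.lt_or_eq with hlt | heq
    · have : 0 < ‖u x‖ := norm_pos_iff.2 (hune x hx)
      have h5 : 0 < 1 - ‖x‖ ^ 2 := by nlinarith [norm_nonneg x]
      positivity
    · have := hsph x heq
      rw [heq]
      positivity
  · rintro x ⟨hx, hDx⟩
    apply ContDiffAt.contDiffWithinAt
    have hl : ContDiffAt ℝ 1 l x := ?_
    · exact hl.smul hu.contDiffAt
    refine ContDiffAt.div ?_ (hu.norm_sq ℝ).contDiffAt (by simpa using hx)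
    exact ((contDiff_id.inner ℝ hu).neg).contDiffAt.add (hD.contDiffAt.sqrt hDx.ne')
  · intro x hx
    have := hsph x hx
    simp [l, D, hx, Real.sqrt_sq this.le]
  · rintro x ⟨hx, hDx⟩
    have hn : ‖u x‖ ≠ 0 := norm_ne_zero_iff.2 hx
    have hs := Real.sq_sqrt hDx.le
    have : ‖x + l x • u x‖ ^ 2 = 1 := by
      rw [norm_add_sq_real, inner_smul_right, norm_smul, mul_pow, Real.norm_eq_abs, sq_abs]
      simp only [l]
      field_simp
      simp only [D] at hs ⊢
      nlinarith [hs]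
    nlinarith [norm_nonneg (x + l x • u x)]

theorem brouwer_fixed_point (n : ℕ)
    (f : C(↥(Metric.closedBall (0 : EuclideanSpace ℝ (Fin n)) 1),
           ↥(Metric.closedBall (0 : EuclideanSpace ℝ (Fin n)) 1))) :
    ∃ x, f x = x := by
  by_contra! hne
  have hP : ∀ x : EuclideanSpace ℝ (Fin n), (max 1 ‖x‖)⁻¹ • x ∈ closedBall 0 1 := by
    intro x
    have : 0 < max 1 ‖x‖ := lt_max_of_lt_left one_pos
    rw [mem_closedBall_zero_iff, norm_smul, norm_inv, Real.norm_of_nonneg this.le,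
      inv_mul_le_iff₀ this]
    simp
  let G : EuclideanSpace ℝ (Fin n) → EuclideanSpace ℝ (Fin n) :=
    fun x => f ⟨(max 1 ‖x‖)⁻¹ • x, hP x⟩
  have hG : Continuous G := by
    refine continuous_subtype_val.comp (f.continuous.comp (Continuous.subtype_mk ?_ _))
    refine Continuous.smul (Continuous.inv₀ (continuous_const.max continuous_norm) ?_) continuous_id
    intro x
    exact (lt_max_of_lt_left one_pos).ne'
  have hG1 : ∀ x, ‖G x‖ ≤ 1 := fun x => mem_closedBall_zero_iff.1 (f ⟨_, hP x⟩).2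
  have hGne : ∀ x, ‖x‖ ≤ 1 → G x ≠ x := by
    intro x hx he
    refine hne ⟨x, by simpa using hx⟩ (Subtype.ext ?_)
    simpa [G, hx] using he
  have hδ : ∃ δ > 0, ∀ x, ‖x‖ ≤ 1 → δ ≤ ‖G x - x‖ := by
    obtain ⟨x, hx, hm⟩ := (isCompact_closedBall (0 : EuclideanSpace ℝ (Fin n)) 1).exists_isMinOn
      ⟨0, by simp⟩ (f := fun x => ‖G x - x‖) (by fun_prop)
    refine ⟨‖G x - x‖, norm_pos_iff.2 (sub_ne_zero.2 (hGne x (by simpa using hx))), ?_⟩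
    intro y hy
    exact hm (by simpa using hy)
  obtain ⟨δ, hδ, hδG⟩ := hδ
  have hδ2 : δ ≤ 1 := by
    simpa using (hδG 0 (by simp)).trans ((by simpa using hG1 0))
  obtain ⟨g, hg, hgd, -⟩ := hG.exists_contDiff_approx 1 (ε := fun _ => δ / 4)
    continuous_const (fun _ => by positivity)
  have hgd' : ∀ x, ‖g x - G x‖ < δ / 4 := fun x => by simpa [dist_eq_norm] using hgd x
  have hgn : ∀ x, ‖g x‖ < 1 + δ / 4 := fun x => by
    have := norm_add_le (g x - G x) (G x)
    rw [sub_add_cancel] at this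
    linarith [hgd' x, hG1 x]
  have hp : 0 < 1 + δ / 4 := by positivity
  refine bfp_smooth (F := fun x => (1 + δ / 4)⁻¹ • g x) (hg.const_smul _) ?_ ?_
  · intro x _
    rw [norm_smul, norm_inv, Real.norm_of_nonneg hp.le, inv_mul_lt_iff₀ hp, mul_one]
    exact hgn x
  · intro x hx he
    have e : g x = (1 + δ / 4) • x := by
      have h6 := congrArg (fun z => (1 + δ / 4) • z) he
      simpa only [smul_inv_smul₀ hp.ne'] using h6
    have h3 := hδG x hx
    have h4 : G x - x = -(g x - G x) + (δ / 4) • x := by rw [e]; module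
    rw [h4] at h3
    have h5 := norm_add_le (-(g x - G x)) ((δ / 4) • x)
    rw [norm_neg, norm_smul, Real.norm_of_nonneg (by positivity)] at h5
    nlinarith [hgd' x]
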